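/- arXiv:2506.08928 — 2 statements merged into one kernel-verified Lean document; each statement's English description precedes it below -/
import Mathlib

section
/- Let s be a split of a node v into nonempty disjoint children v_L and v_R, and let β_s = (Σ_{i=1}^{n} y_i · ψ(i; s)) / |v| be the least-squares coefficient of the stump function. Then for every i ∈ v_L one has β_s · ψ(i; s) = ȳ_{v_L} − ȳ_v, and for every i ∈ v_R one has β_s · ψ(i; s) = ȳ_{v_R} − ȳ_v. That is, adding the stump regression term updates the parent-node mean prediction to the corresponding child-node mean prediction. -/
open Finset

variable {n : ℕ}

/-- Mean response of the training samples in node `v`. -/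
noncomputable def nodeMean (y : Fin n → ℝ) (v : Finset (Fin n)) : ℝ :=
  ((v.card : ℝ))⁻¹ * ∑ i ∈ v, y i

/-- Stump function of the split of a node into children `vL`, `vR`. -/
noncomputable def stump (vL vR : Finset (Fin n)) (i : Fin n) : ℝ :=
  ((vR.card : ℝ) * (if i ∈ vL then (1 : ℝ) else 0)
      - (vL.card : ℝ) * (if i ∈ vR then (1 : ℝ) else 0))
    / Real.sqrt ((vL.card : ℝ) * (vR.card : ℝ))

/-- Impurity decrease of the split of node `vL ∪ vR` into children `vL`, `vR`. -/
noncomputable def impurityDecrease (y : Fin n → ℝ) (vL vR : Finset (Fin n)) : ℝ :=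
  (((vL ∪ vR).card : ℝ))⁻¹ *
    ((∑ i ∈ vL ∪ vR, (y i - nodeMean y (vL ∪ vR)) ^ 2)
      - (∑ i ∈ vL, (y i - nodeMean y vL) ^ 2)
      - (∑ i ∈ vR, (y i - nodeMean y vR) ^ 2))

theorem sum_mul_stump (y : Fin n → ℝ) (vL vR : Finset (Fin n)) :
    ∑ i, y i * stump vL vR i =
      ((vR.card : ℝ) * ∑ i ∈ vL, y i - (vL.card : ℝ) * ∑ i ∈ vR, y i) /
        Real.sqrt ((vL.card : ℝ) * (vR.card : ℝ)) := by
  have key (v : Finset (Fin n)) : ∑ i ∈ v, y i = ∑ i, y i * (if i ∈ v then (1 : ℝ) else 0) := by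
    simp
  rw [key vL, key vR, mul_sum, mul_sum, ← sum_sub_distrib, sum_div]
  refine sum_congr rfl fun i _ => ?_
  unfold stump
  ring

theorem stump_of_mem_left {vL vR : Finset (Fin n)} (hd : Disjoint vL vR) {i : Fin n}
    (hi : i ∈ vL) :
    stump vL vR i = (vR.card : ℝ) / Real.sqrt ((vL.card : ℝ) * (vR.card : ℝ)) := by
  simp [stump, hi, disjoint_left.mp hd hi]

theorem stump_of_mem_right {vL vR : Finset (Fin n)} (hd : Disjoint vL vR) {i : Fin n}
    (hi : i ∈ vR) :
    stump vL vR i = -(vL.card : ℝ) / Real.sqrt ((vL.card : ℝ) * (vR.card : ℝ)) := by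
  simp [stump, hi, disjoint_right.mp hd hi]

theorem stump_coefficient_updates_mean (y : Fin n → ℝ) (vL vR : Finset (Fin n))
    (hL : vL.Nonempty) (hR : vR.Nonempty) (hd : Disjoint vL vR) :
    let β := (∑ i, y i * stump vL vR i) / ((vL ∪ vR).card : ℝ)
    (∀ i ∈ vL, β * stump vL vR i = nodeMean y vL - nodeMean y (vL ∪ vR))
    ∧ (∀ i ∈ vR, β * stump vL vR i = nodeMean y vR - nodeMean y (vL ∪ vR)) := by
  have hl : (0 : ℝ) < vL.card := by exact_mod_cast hL.card_pos
  have hr : (0 : ℝ) < vR.card := by exact_mod_cast hR.card_pos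
  have hsq : Real.sqrt ((vL.card : ℝ) * vR.card) ^ 2 = (vL.card : ℝ) * vR.card :=
    Real.sq_sqrt (by positivity)
  have hs : 0 < Real.sqrt ((vL.card : ℝ) * vR.card) := by positivity
  intro β
  simp only [β, sum_mul_stump, nodeMean, sum_union hd, card_union_of_disjoint hd, Nat.cast_add]
  refine ⟨fun i hi => ?_, fun i hi => ?_⟩
  · rw [stump_of_mem_left hd hi]
    generalize Real.sqrt ((vL.card : ℝ) * vR.card) = t at hsq hs ⊢
    field_simp
    rw [hsq]
    ring
  · rw [stump_of_mem_right hd hi]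
    generalize Real.sqrt ((vL.card : ℝ) * vR.card) = t at hsq hs ⊢
    field_simp
    rw [hsq]
    ring
end

section
/- Let S = {s_1, …, s_m} be a finite family of splits satisfying the tree (laminar) condition, and define the fitted values ŷ_i = ȳ + Σ_{j=1}^{m} β_j ψ(i; s_j), where ȳ = n⁻¹ Σ_{i=1}^{n} y_i and β_j = (Σ_{i=1}^{n} y_i ψ(i; s_j)) / |v_j|. Then the Pythagorean residual decomposition holds: Σ_{i=1}^{n} (y_i − ŷ_i)² = Σ_{i=1}^{n} (y_i − ȳ)² − Σ_{j=1}^{m} (Σ_{i=1}^{n} y_i ψ(i; s_j))² / |v_j|. -/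
open Finset

variable {n : ℕ}

/-- A stump function sums to zero over the samples. -/
lemma sum_stump (vL vR : Finset (Fin n)) : ∑ i, stump vL vR i = 0 := by
  simp only [stump, ← Finset.sum_div, Finset.sum_sub_distrib, ← Finset.mul_sum]
  simp [mul_comm]

/-- A stump function vanishes outside the node being split. -/
lemma stump_eq_zero_of_notMem {vL vR : Finset (Fin n)} {i : Fin n} (hi : i ∉ vL ∪ vR) :
    stump vL vR i = 0 := by
  simp only [Finset.mem_union, not_or] at hi
  simp [stump, hi.1, hi.2]

/-- The squared norm of a stump function is the size of the node being split. -/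
lemma sum_stump_sq {vL vR : Finset (Fin n)} (hL : vL.Nonempty) (hR : vR.Nonempty)
    (hd : Disjoint vL vR) :
    ∑ i, stump vL vR i * stump vL vR i = ((vL ∪ vR).card : ℝ) := by
  have hl : (0 : ℝ) < vL.card := by exact_mod_cast hL.card_pos
  have hr : (0 : ℝ) < vR.card := by exact_mod_cast hR.card_pos
  have key : ∀ i, stump vL vR i * stump vL vR i
      = ((vR.card : ℝ) / vL.card) * (if i ∈ vL then (1 : ℝ) else 0)
        + ((vL.card : ℝ) / vR.card) * (if i ∈ vR then (1 : ℝ) else 0) := by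
    intro i
    rw [stump, div_mul_div_comm, Real.mul_self_sqrt (by positivity)]
    by_cases h1 : i ∈ vL
    · have h2 : i ∉ vR := Finset.disjoint_left.mp hd h1
      simp only [h1, h2, if_true, if_false]
      field_simp
      ring
    · by_cases h2 : i ∈ vR
      · simp only [h1, h2, if_true, if_false]
        field_simp
        ring
      · simp [h1, h2]
  simp only [key, Finset.sum_add_distrib, ← Finset.mul_sum]
  rw [Finset.card_union_of_disjoint hd]
  simp
  field_simp
  ring

/-- A stump function is orthogonal to every function that is constant on the node being split. -/
lemma sum_stump_mul_eq_zero {vL vR : Finset (Fin n)} {f : Fin n → ℝ} {c : ℝ}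
    (hf : ∀ i ∈ vL ∪ vR, f i = c) : ∑ i, stump vL vR i * f i = 0 := by
  calc ∑ i, stump vL vR i * f i = ∑ i, stump vL vR i * c := by
        refine Finset.sum_congr rfl fun i _ => ?_
        by_cases hi : i ∈ vL ∪ vR
        · rw [hf i hi]
        · rw [stump_eq_zero_of_notMem hi, zero_mul, zero_mul]
    _ = 0 := by rw [← Finset.sum_mul, sum_stump, zero_mul]

/-- The stump function of a split is orthogonal to that of any split with a child containing
the node of the first one. -/
lemma sum_stump_mul_stump_of_subset {vL vR wL wR : Finset (Fin n)} (hd : Disjoint wL wR)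
    (h : vL ∪ vR ⊆ wL ∨ vL ∪ vR ⊆ wR) :
    ∑ i, stump vL vR i * stump wL wR i = 0 := by
  rcases h with h | h
  · refine sum_stump_mul_eq_zero
      (c := (wR.card : ℝ) / Real.sqrt ((wL.card : ℝ) * (wR.card : ℝ))) fun i hi => ?_
    simp [stump, h hi, Finset.disjoint_left.mp hd (h hi)]
  · refine sum_stump_mul_eq_zero
      (c := -(wL.card : ℝ) / Real.sqrt ((wL.card : ℝ) * (wR.card : ℝ))) fun i hi => ?_
    simp [stump, h hi, Finset.disjoint_right.mp hd (h hi)]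

/-- Stump functions of splits of disjoint nodes are orthogonal. -/
lemma sum_stump_mul_stump_of_disjoint {vL vR wL wR : Finset (Fin n)}
    (h : Disjoint (vL ∪ vR) (wL ∪ wR)) :
    ∑ i, stump vL vR i * stump wL wR i = 0 :=
  sum_stump_mul_eq_zero fun _ hi => stump_eq_zero_of_notMem (Finset.disjoint_left.mp h hi)

/-- Pythagorean identity for the residual of the projection onto an orthogonal family. -/
lemma sum_sub_projection_sq {ι κ : Type*} [Fintype ι] [Fintype κ] (r : ι → ℝ) (ψ : κ → ι → ℝ)
    (N : κ → ℝ) (hN : ∀ j, N j ≠ 0) (hself : ∀ j, ∑ i, ψ j i * ψ j i = N j)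
    (horth : ∀ j k, j ≠ k → ∑ i, ψ j i * ψ k i = 0) :
    ∑ i, (r i - ∑ j, (∑ i, r i * ψ j i) / N j * ψ j i) ^ 2
      = ∑ i, r i ^ 2 - ∑ j, (∑ i, r i * ψ j i) ^ 2 / N j := by
  set a : κ → ℝ := fun j => ∑ i, r i * ψ j i with ha
  have hcross : ∑ i, r i * ∑ j, a j / N j * ψ j i = ∑ j, a j ^ 2 / N j := by
    simp only [Finset.mul_sum]
    rw [Finset.sum_comm]
    refine Finset.sum_congr rfl fun j _ => ?_
    calc ∑ i, r i * (a j / N j * ψ j i) = a j / N j * ∑ i, r i * ψ j i := by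
          rw [Finset.mul_sum]
          exact Finset.sum_congr rfl fun i _ => by ring
      _ = a j ^ 2 / N j := by
          change a j / N j * a j = _
          ring
  have hinner : ∀ k, ∑ i, (∑ j, a j / N j * ψ j i) * ψ k i = a k := by
    intro k
    simp only [Finset.sum_mul]
    rw [Finset.sum_comm]
    simp only [mul_assoc, ← Finset.mul_sum]
    rw [Finset.sum_eq_single k (fun j _ hj => by rw [horth j k hj, mul_zero]) (by simp),
      hself, div_mul_cancel₀ _ (hN k)]
  have hsq : ∑ i, (∑ j, a j / N j * ψ j i) ^ 2 = ∑ j, a j ^ 2 / N j := by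
    calc ∑ i, (∑ j, a j / N j * ψ j i) ^ 2
        = ∑ k, a k / N k * ∑ i, (∑ j, a j / N j * ψ j i) * ψ k i := by
          simp only [Finset.mul_sum (s := (Finset.univ : Finset ι))]
          rw [Finset.sum_comm]
          refine Finset.sum_congr rfl fun i _ => ?_
          rw [sq, Finset.mul_sum]
          exact Finset.sum_congr rfl fun k _ => by ring
      _ = ∑ j, a j ^ 2 / N j := by
          refine Finset.sum_congr rfl fun k _ => ?_
          rw [hinner]
          ring
  calc ∑ i, (r i - ∑ j, a j / N j * ψ j i) ^ 2
      = ∑ i, r i ^ 2 - 2 * ∑ i, r i * ∑ j, a j / N j * ψ j i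
          + ∑ i, (∑ j, a j / N j * ψ j i) ^ 2 := by
        rw [Finset.mul_sum, ← Finset.sum_sub_distrib, ← Finset.sum_add_distrib]
        exact Finset.sum_congr rfl fun i _ => by ring
    _ = ∑ i, r i ^ 2 - ∑ j, a j ^ 2 / N j := by
        rw [hcross, hsq]
        ring

theorem pythagorean_residual_decomposition {m : ℕ} (y : Fin n → ℝ)
    (vL vR : Fin m → Finset (Fin n))
    (hL : ∀ j, (vL j).Nonempty) (hR : ∀ j, (vR j).Nonempty)
    (hd : ∀ j, Disjoint (vL j) (vR j))
    (laminar : ∀ j j', j ≠ j' →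
      Disjoint (vL j ∪ vR j) (vL j' ∪ vR j')
      ∨ (vL j ∪ vR j) ⊆ vL j' ∨ (vL j ∪ vR j) ⊆ vR j'
      ∨ (vL j' ∪ vR j') ⊆ vL j ∨ (vL j' ∪ vR j') ⊆ vR j) :
    let ybar := (n : ℝ)⁻¹ * ∑ i, y i
    let β := fun j => (∑ i, y i * stump (vL j) (vR j) i) / (((vL j ∪ vR j).card : ℝ))
    let yhat := fun i => ybar + ∑ j, β j * stump (vL j) (vR j) i
    ∑ i, (y i - yhat i) ^ 2
      = ∑ i, (y i - ybar) ^ 2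
        - ∑ j, (∑ i, y i * stump (vL j) (vR j) i) ^ 2 / (((vL j ∪ vR j).card : ℝ)) := by
  intro ybar β yhat
  have hcenter : ∀ j, ∑ i, (y i - ybar) * stump (vL j) (vR j) i
      = ∑ i, y i * stump (vL j) (vR j) i := by
    intro j
    simp only [sub_mul, Finset.sum_sub_distrib, ← Finset.mul_sum, sum_stump, mul_zero, sub_zero]
  have hcard : ∀ j, ((vL j ∪ vR j).card : ℝ) ≠ 0 := fun j =>
    Nat.cast_ne_zero.mpr ((hL j).mono Finset.subset_union_left).card_ne_zero
  have horth : ∀ j k, j ≠ k → ∑ i, stump (vL j) (vR j) i * stump (vL k) (vR k) i = 0 := by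
    intro j k hjk
    rcases laminar j k hjk with h | h | h | h | h
    · exact sum_stump_mul_stump_of_disjoint h
    · exact sum_stump_mul_stump_of_subset (hd k) (Or.inl h)
    · exact sum_stump_mul_stump_of_subset (hd k) (Or.inr h)
    · simpa only [mul_comm] using sum_stump_mul_stump_of_subset (hd j) (Or.inl h)
    · simpa only [mul_comm] using sum_stump_mul_stump_of_subset (hd j) (Or.inr h)
  have key := sum_sub_projection_sq (fun i => y i - ybar) (fun j => stump (vL j) (vR j))
    (fun j => ((vL j ∪ vR j).card : ℝ)) hcard
    (fun j => sum_stump_sq (hL j) (hR j) (hd j)) horth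
  simp only [hcenter, sub_sub] at key
  simpa only [yhat, β, sub_sub] using key
end
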